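/- Let f : S^m → ℝ be smooth and consider the conformal metric e^{2f}σ on the round sphere (S^m, σ), m ≥ 3. Then e^{2f}σ has constant scalar curvature if and only if e^{-f} is a linear combination of the constant function and first eigenfunctions (restrictions of linear functions of ℝ^{m+1}) of the Laplacian on (S^m, σ). -/

import Mathlib

open Real Finset

/-! Obata-type characterization of constant scalar curvature metrics in the
conformal class of the round sphere (S^m, σ), m ≥ 3.  A function on S^m is
represented by its 0-homogeneous extension f to ℝ^{m+1}\{0}; then the
spherical Laplacian and gradient of f on the unit sphere coincide with the
Euclidean ones of the extension, and the scalar curvature of e^{2f}σ is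
e^{-2f}(m(m−1) − 2(m−1)Δ_σ f − (m−1)(m−2)|∇_σ f|²). -/

variable {m : ℕ}

/-- i-th Euclidean partial derivative. -/
noncomputable def epd (i : Fin (m + 1)) (f : EuclideanSpace ℝ (Fin (m + 1)) → ℝ)
    (x : EuclideanSpace ℝ (Fin (m + 1))) : ℝ :=
  fderiv ℝ f x (EuclideanSpace.single i 1)

/-- Euclidean Laplacian. -/
noncomputable def eucLap (f : EuclideanSpace ℝ (Fin (m + 1)) → ℝ)
    (x : EuclideanSpace ℝ (Fin (m + 1))) : ℝ :=
  ∑ i, epd i (epd i f) x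

/-- Squared norm of the Euclidean gradient. -/
noncomputable def eucGradSq (f : EuclideanSpace ℝ (Fin (m + 1)) → ℝ)
    (x : EuclideanSpace ℝ (Fin (m + 1))) : ℝ :=
  ∑ i, (epd i f x) ^ 2

/-- Smoothness at every point of the punctured Euclidean space. -/
def SmoothOffZero (F : EuclideanSpace ℝ (Fin (m + 1)) → ℝ) : Prop :=
  ∀ x, x ≠ 0 → ContDiffAt ℝ (⊤ : ℕ∞) F x

section calculus

variable {F G : EuclideanSpace ℝ (Fin (m + 1)) → ℝ} {x : EuclideanSpace ℝ (Fin (m + 1))}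

lemma SmoothOffZero.differentiableAt (hF : SmoothOffZero F) (hx : x ≠ 0) :
    DifferentiableAt ℝ F x :=
  (hF x hx).differentiableAt (by simp)

lemma SmoothOffZero.epd (hF : SmoothOffZero F) (i : Fin (m + 1)) : SmoothOffZero (epd i F) := by
  intro x hx
  have h : ContDiffAt ℝ (⊤ : ℕ∞) (fderiv ℝ F) x := (hF x hx).fderiv_right (by simp)
  exact h.clm_apply contDiffAt_const

lemma SmoothOffZero.mul (hF : SmoothOffZero F) (hG : SmoothOffZero G) :
    SmoothOffZero (fun y => F y * G y) := fun x hx => (hF x hx).mul (hG x hx)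

lemma SmoothOffZero.sub (hF : SmoothOffZero F) (hG : SmoothOffZero G) :
    SmoothOffZero (fun y => F y - G y) := fun x hx => (hF x hx).sub (hG x hx)

lemma SmoothOffZero.sum {ι : Type*} {s : Finset ι}
    {F : ι → EuclideanSpace ℝ (Fin (m + 1)) → ℝ} (hF : ∀ i, SmoothOffZero (F i)) :
    SmoothOffZero (fun y => ∑ i ∈ s, F i y) :=
  fun x hx => ContDiffAt.sum fun i _ => hF i x hx

lemma SmoothOffZero.const (c : ℝ) :
    SmoothOffZero (fun _ : EuclideanSpace ℝ (Fin (m + 1)) => c) :=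
  fun _ _ => contDiffAt_const

lemma SmoothOffZero.coord (i : Fin (m + 1)) :
    SmoothOffZero (fun y : EuclideanSpace ℝ (Fin (m + 1)) => y i) :=
  fun _ _ => (EuclideanSpace.proj (𝕜 := ℝ) i).contDiff.contDiffAt

lemma SmoothOffZero.norm :
    SmoothOffZero (fun y : EuclideanSpace ℝ (Fin (m + 1)) => ‖y‖) :=
  fun _ hx => contDiffAt_norm ℝ hx

lemma SmoothOffZero.coord_div_norm (i : Fin (m + 1)) :
    SmoothOffZero (fun y : EuclideanSpace ℝ (Fin (m + 1)) => y i / ‖y‖) :=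
  fun x hx => (SmoothOffZero.coord i x hx).div (SmoothOffZero.norm x hx) (norm_ne_zero_iff.2 hx)

lemma SmoothOffZero.eucLap (hF : SmoothOffZero F) : SmoothOffZero (eucLap F) :=
  SmoothOffZero.sum fun i => (hF.epd i).epd i

lemma epd_congr (h : ∀ y, y ≠ 0 → F y = G y) (hx : x ≠ 0) (i : Fin (m + 1)) :
    epd i F x = epd i G x := by
  have : F =ᶠ[nhds x] G := by
    filter_upwards [isOpen_ne.mem_nhds hx] with y hy using h y hy
  simp only [epd, this.fderiv_eq]

lemma epd_const (c : ℝ) (i : Fin (m + 1)) : epd i (fun _ => c) x = 0 := by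
  simp [epd]

lemma epd_add (hF : DifferentiableAt ℝ F x) (hG : DifferentiableAt ℝ G x) (i : Fin (m + 1)) :
    epd i (fun y => F y + G y) x = epd i F x + epd i G x := by
  simp only [epd, fderiv_fun_add hF hG, add_apply]

lemma epd_sub (hF : DifferentiableAt ℝ F x) (hG : DifferentiableAt ℝ G x) (i : Fin (m + 1)) :
    epd i (fun y => F y - G y) x = epd i F x - epd i G x := by
  simp only [epd, fderiv_fun_sub hF hG, sub_apply]

lemma epd_mul (hF : DifferentiableAt ℝ F x) (hG : DifferentiableAt ℝ G x) (i : Fin (m + 1)) :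
    epd i (fun y => F y * G y) x = epd i F x * G x + F x * epd i G x := by
  simp only [epd, fderiv_fun_mul hF hG, add_apply,
    smul_apply, smul_eq_mul]
  ring

lemma epd_const_mul (hF : DifferentiableAt ℝ F x) (c : ℝ) (i : Fin (m + 1)) :
    epd i (fun y => c * F y) x = c * epd i F x := by
  rw [epd_mul (differentiableAt_const c) hF, epd_const, zero_mul, zero_add]

lemma epd_sum {ι : Type*} {s : Finset ι} {F : ι → EuclideanSpace ℝ (Fin (m + 1)) → ℝ}
    (hF : ∀ j, DifferentiableAt ℝ (F j) x) (i : Fin (m + 1)) :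
    epd i (fun y => ∑ j ∈ s, F j y) x = ∑ j ∈ s, epd i (F j) x := by
  simp only [epd, fderiv_fun_sum fun j _ => hF j, _root_.sum_apply]

lemma epd_comp {h : ℝ → ℝ} {h' : ℝ} (hh : HasDerivAt h h' (F x)) (hF : DifferentiableAt ℝ F x)
    (i : Fin (m + 1)) : epd i (fun y => h (F y)) x = h' * epd i F x := by
  have : HasFDerivAt (fun y => h (F y)) (h' • fderiv ℝ F x) x :=
    hh.comp_hasFDerivAt x hF.hasFDerivAt
  simp [epd, this.fderiv]

lemma epd_coord (i j : Fin (m + 1)) :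
    epd i (fun y => y j) x = if i = j then 1 else 0 := by
  have : fderiv ℝ (fun y : EuclideanSpace ℝ (Fin (m + 1)) => y j) x
      = EuclideanSpace.proj (𝕜 := ℝ) j := (EuclideanSpace.proj (𝕜 := ℝ) j).fderiv
  simp [epd, this, eq_comm]

lemma epd_linear (L : EuclideanSpace ℝ (Fin (m + 1)) →ₗ[ℝ] ℝ) (i : Fin (m + 1)) :
    epd i (fun y => L y) x = L (EuclideanSpace.single i 1) := by
  have : fderiv ℝ (fun y => L y) x = L.toContinuousLinearMap := L.toContinuousLinearMap.fderiv
  simp [epd, this]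

lemma epd_norm_sq (i : Fin (m + 1)) : epd i (fun y => ‖y‖ ^ 2) x = 2 * x i := by
  have := (hasStrictFDerivAt_norm_sq x).hasFDerivAt.fderiv
  simp only [epd, this]
  simp [EuclideanSpace.inner_single_right]

lemma epd_norm (hx : x ≠ 0) (i : Fin (m + 1)) :
    epd i (fun y => ‖y‖) x = x i / ‖x‖ := by
  have hn : ‖x‖ ≠ 0 := norm_ne_zero_iff.2 hx
  have hd := SmoothOffZero.norm.differentiableAt hx
  have h := epd_norm_sq (x := x) i
  simp only [pow_two] at h
  rw [epd_mul hd hd] at h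
  field_simp
  linarith

lemma epd_coord_div_norm (hx : x ≠ 0) (i j : Fin (m + 1)) :
    epd i (fun y => y j / ‖y‖) x =
      ((if i = j then 1 else 0) - x i * x j / ‖x‖ ^ 2) / ‖x‖ := by
  have hn : ‖x‖ ≠ 0 := norm_ne_zero_iff.2 hx
  have h := epd_mul ((SmoothOffZero.coord_div_norm j).differentiableAt hx)
    (SmoothOffZero.norm.differentiableAt hx) i
  rw [epd_congr (G := fun y => y j) (fun y hy => by
    have := norm_ne_zero_iff.2 hy
    field_simp) hx, epd_coord, epd_norm hx] at h
  field_simp at h ⊢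
  linarith

lemma epd_comm (hF : SmoothOffZero F) (hx : x ≠ 0) (i j : Fin (m + 1)) :
    epd i (epd j F) x = epd j (epd i F) x := by
  have hs : IsSymmSndFDerivAt ℝ F x := (hF x hx).isSymmSndFDerivAt (by
    rw [minSmoothness_of_isRCLikeNormedField]; exact WithTop.coe_le_coe.2 le_top)
  have hd : DifferentiableAt ℝ (fderiv ℝ F) x :=
    ((hF x hx).fderiv_right (m := (⊤ : ℕ∞)) (by simp)).differentiableAt (by simp)
  have key : ∀ a b : Fin (m + 1), epd a (epd b F) x =
      fderiv ℝ (fderiv ℝ F) x (EuclideanSpace.single a 1) (EuclideanSpace.single b 1) := by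
    intro a b
    change fderiv ℝ (fun y => fderiv ℝ F y (EuclideanSpace.single b 1)) x _ = _
    rw [fderiv_clm_apply hd (differentiableAt_const _)]
    simp
  rw [key, key]
  exact hs _ _

lemma sum_coord_sq (x : EuclideanSpace ℝ (Fin (m + 1))) : ∑ i, x i ^ 2 = ‖x‖ ^ 2 := by
  simp [EuclideanSpace.norm_sq_eq]

lemma fderiv_apply_eq_sum_epd (F : EuclideanSpace ℝ (Fin (m + 1)) → ℝ)
    (x v : EuclideanSpace ℝ (Fin (m + 1))) :
    fderiv ℝ F x v = ∑ i, v i * epd i F x := by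
  conv_lhs => rw [← (EuclideanSpace.basisFun (Fin (m + 1)) ℝ).sum_repr v]
  simp [epd]

lemma smul_epd_smul {c a : ℝ} (hc : c ≠ 0) (hF : SmoothOffZero F)
    (h : ∀ y, y ≠ 0 → F (c • y) = a * F y) (hx : x ≠ 0) (i : Fin (m + 1)) :
    c * epd i F (c • x) = a * epd i F x := by
  have hcx : c • x ≠ 0 := smul_ne_zero hc hx
  rw [← epd_const_mul (hF.differentiableAt hx), ← epd_congr h hx]
  have h1 : HasFDerivAt (fun y : EuclideanSpace ℝ (Fin (m + 1)) => F (c • y)) _ x :=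
    (hF.differentiableAt hcx).hasFDerivAt.comp x ((hasFDerivAt_id x).const_smul c)
  rw [epd, epd, h1.fderiv]
  simp

lemma sum_coord_mul_epd_eq_deriv {a : ℝ → ℝ} {a' : ℝ} (hF : SmoothOffZero F) (hx : x ≠ 0)
    (h : ∀ c > 0, F (c • x) = a c * F x) (ha : HasDerivAt a a' 1) :
    ∑ i, x i * epd i F x = a' * F x := by
  rw [← fderiv_apply_eq_sum_epd]
  have h1 : HasDerivAt (fun c : ℝ => F (c • x)) (fderiv ℝ F x x) 1 := by
    have hd : HasFDerivAt F (fderiv ℝ F x) ((1 : ℝ) • x) := by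
      rw [one_smul]; exact (hF.differentiableAt hx).hasFDerivAt
    have := hd.comp_hasDerivAt (1 : ℝ) ((hasDerivAt_id (1 : ℝ)).smul_const x)
    rwa [one_smul] at this
  have h2 : HasDerivAt (fun c : ℝ => F (c • x)) (a' * F x) 1 :=
    (ha.mul_const (F x)).congr_of_eventuallyEq (by
      filter_upwards [lt_mem_nhds (one_pos : (0 : ℝ) < 1)] with c hc using h c hc)
  exact h1.unique h2

end calculus

section homogeneous

variable {U : EuclideanSpace ℝ (Fin (m + 1)) → ℝ} {x : EuclideanSpace ℝ (Fin (m + 1))}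

lemma sum_coord_mul_epd (hU : SmoothOffZero U)
    (hhom : ∀ x, ∀ c > (0 : ℝ), U (c • x) = c * U x) (hx : x ≠ 0) :
    ∑ i, x i * epd i U x = U x := by
  rw [sum_coord_mul_epd_eq_deriv hU hx (hhom x) (hasDerivAt_id 1), one_mul]

lemma sum_coord_mul_epd_epd (hU : SmoothOffZero U)
    (hhom : ∀ x, ∀ c > (0 : ℝ), U (c • x) = c * U x) (hx : x ≠ 0) (i : Fin (m + 1)) :
    ∑ j, x j * epd i (epd j U) x = 0 := by
  have h := epd_congr (fun y hy => sum_coord_mul_epd hU hhom hy) hx i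
  rw [epd_sum fun j => ((SmoothOffZero.coord j).mul (hU.epd j)).differentiableAt hx] at h
  simp only [fun j => epd_mul ((SmoothOffZero.coord j).differentiableAt hx)
    ((hU.epd j).differentiableAt hx) i, epd_coord, sum_add_distrib, ite_mul, one_mul, zero_mul,
    sum_ite_eq, mem_univ, if_true] at h
  linarith

lemma sum_coord_mul_epd_eucLap (hU : SmoothOffZero U)
    (hhom : ∀ x, ∀ c > (0 : ℝ), U (c • x) = c * U x) (hx : x ≠ 0) :
    ∑ j, x j * epd j (eucLap U) x = -eucLap U x := by
  have h : ∀ i, epd i (epd i U) x + ∑ j, x j * epd j (epd i (epd i U)) x = 0 := by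
    intro i
    have h := epd_congr (fun y hy => sum_coord_mul_epd_epd hU hhom hy i) hx i
    rw [epd_const, epd_sum fun j =>
      ((SmoothOffZero.coord j).mul ((hU.epd j).epd i)).differentiableAt hx] at h
    simp only [fun j => epd_mul ((SmoothOffZero.coord j).differentiableAt hx)
      (((hU.epd j).epd i).differentiableAt hx) i, epd_coord, sum_add_distrib, ite_mul, one_mul,
      zero_mul, sum_ite_eq, mem_univ, if_true] at h
    rw [← h]
    congr 1
    refine sum_congr rfl fun j _ => ?_
    rw [epd_comm (hU.epd i) hx j i, epd_congr (fun y hy => epd_comm hU hy j i) hx i]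
  have h' := sum_congr (rfl : (univ : Finset (Fin (m + 1))) = univ) fun i _ => h i
  rw [sum_add_distrib, sum_comm, sum_const_zero] at h'
  have e : ∀ j, epd j (eucLap U) x = ∑ i, epd j (epd i (epd i U)) x := fun j =>
    epd_sum (fun i => ((hU.epd i).epd i).differentiableAt hx) j
  simp only [e, mul_sum]
  change eucLap U x + _ = 0 at h'
  linarith

end homogeneous

section equation

variable {U : EuclideanSpace ℝ (Fin (m + 1)) → ℝ} {x : EuclideanSpace ℝ (Fin (m + 1))} {κ : ℝ}

lemma mul_epd_eucLap (hm : m ≠ 0) (hU : SmoothOffZero U)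
    (heq : ∀ x, x ≠ 0 → 2 / m * (U x * eucLap U x) - eucGradSq U x = κ) (hx : x ≠ 0)
    (i : Fin (m + 1)) :
    U x * epd i (eucLap U) x =
      m * ∑ j, epd i (epd j U) x * epd j U x - eucLap U x * epd i U x := by
  have hm' : (m : ℝ) ≠ 0 := Nat.cast_ne_zero.2 hm
  have h := epd_congr heq hx i
  have hd := hU.differentiableAt hx
  have hg := hU.eucLap.differentiableAt hx
  have hsq : eucGradSq U = fun y => ∑ j, epd j U y * epd j U y := by
    ext y; simp only [eucGradSq, pow_two]
  have hS : SmoothOffZero (eucGradSq U) := by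
    rw [hsq]
    exact SmoothOffZero.sum fun j => (hU.epd j).mul (hU.epd j)
  have e : epd i (eucGradSq U) x = 2 * ∑ j, epd i (epd j U) x * epd j U x := by
    rw [hsq, epd_sum fun j => ((hU.epd j).mul (hU.epd j)).differentiableAt hx, mul_sum]
    refine sum_congr rfl fun j _ => ?_
    rw [epd_mul ((hU.epd j).differentiableAt hx) ((hU.epd j).differentiableAt hx)]
    ring
  rw [epd_const, epd_sub (((SmoothOffZero.const _).mul (hU.mul hU.eucLap)).differentiableAt hx)
    (hS.differentiableAt hx), epd_const_mul (hd.fun_mul hg), epd_mul hd hg, e] at h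
  field_simp at h
  linarith

lemma mul_eucLap_eucLap (hm : m ≠ 0) (hU : SmoothOffZero U)
    (heq : ∀ x, x ≠ 0 → 2 / m * (U x * eucLap U x) - eucGradSq U x = κ) (hx : x ≠ 0) :
    U x * eucLap (eucLap U) x = (m - 2) * ∑ i, epd i U x * epd i (eucLap U) x
      + m * ∑ i, ∑ j, epd i (epd j U) x ^ 2 - eucLap U x ^ 2 := by
  have hd := hU.differentiableAt hx
  have hg := hU.eucLap.differentiableAt hx
  have h : ∀ i, epd i U x * epd i (eucLap U) x + U x * epd i (epd i (eucLap U)) x =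
      m * ∑ j, epd j (epd i (epd i U)) x * epd j U x + m * ∑ j, epd i (epd j U) x ^ 2
        - epd i U x * epd i (eucLap U) x - eucLap U x * epd i (epd i U) x := by
    intro i
    have h := epd_congr (fun y hy => mul_epd_eucLap hm hU heq hy i) hx i
    have hs : ∀ j, SmoothOffZero fun y => epd i (epd j U) y * epd j U y :=
      fun j => ((hU.epd j).epd i).mul (hU.epd j)
    have hs' := SmoothOffZero.sum (s := univ) hs
    rw [epd_mul hd ((hU.eucLap.epd i).differentiableAt hx),
      epd_sub (((SmoothOffZero.const _).mul hs').differentiableAt hx)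
        ((hU.eucLap.mul (hU.epd i)).differentiableAt hx),
      epd_const_mul (hs'.differentiableAt hx), epd_sum fun j => (hs j).differentiableAt hx,
      epd_mul hg ((hU.epd i).differentiableAt hx)] at h
    have e : ∀ j, epd i (fun y => epd i (epd j U) y * epd j U y) x =
        epd j (epd i (epd i U)) x * epd j U x + epd i (epd j U) x ^ 2 := by
      intro j
      rw [epd_mul (((hU.epd j).epd i).differentiableAt hx) ((hU.epd j).differentiableAt hx),
        epd_comm (hU.epd i) hx j i, epd_congr (fun y hy => epd_comm hU hy j i) hx i]
      ring
    simp only [e, sum_add_distrib] at h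
    linarith
  have h' := sum_congr (rfl : (univ : Finset (Fin (m + 1))) = univ) fun i _ => h i
  simp only [sum_add_distrib, sum_sub_distrib, ← mul_sum] at h'
  rw [sum_comm] at h'
  have e : ∀ j, epd j (eucLap U) x = ∑ i, epd j (epd i (epd i U)) x := fun j =>
    epd_sum (fun i => ((hU.epd i).epd i).differentiableAt hx) j
  simp only [← sum_mul, ← e] at h'
  have c : ∑ i, epd i (eucLap U) x * epd i U x = ∑ i, epd i U x * epd i (eucLap U) x :=
    sum_congr rfl fun i _ => mul_comm _ _
  rw [c] at h'
  change _ + U x * eucLap (eucLap U) x = _ - eucLap U x * eucLap U x at h'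
  linarith

lemma sum_sq_traceFree (hm : m ≠ 0) (hU : SmoothOffZero U)
    (hhom : ∀ x, ∀ c > (0 : ℝ), U (c • x) = c * U x) (hx : x ≠ 0) :
    ∑ i, ∑ j, (epd i (epd j U) x
        - eucLap U x / m * ((if i = j then 1 else 0) - x i * x j / ‖x‖ ^ 2)) ^ 2 =
      ∑ i, ∑ j, epd i (epd j U) x ^ 2 - eucLap U x ^ 2 / m := by
  have hm' : (m : ℝ) ≠ 0 := Nat.cast_ne_zero.2 hm
  have hn : ‖x‖ ≠ 0 := norm_ne_zero_iff.2 hx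
  have h2 := sum_coord_sq x
  set t := eucLap U x / m with ht
  have row : ∀ i, ∑ j, (epd i (epd j U) x
        - t * ((if i = j then 1 else 0) - x i * x j / ‖x‖ ^ 2)) ^ 2 =
      ∑ j, epd i (epd j U) x ^ 2 - 2 * t * epd i (epd i U) x
        + t ^ 2 * (1 - x i ^ 2 / ‖x‖ ^ 2) := by
    intro i
    have e : ∀ j, (epd i (epd j U) x
        - t * ((if i = j then 1 else 0) - x i * x j / ‖x‖ ^ 2)) ^ 2 =
        epd i (epd j U) x ^ 2 - (if i = j then 2 * t * epd i (epd j U) x else 0)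
        + 2 * t * x i / ‖x‖ ^ 2 * (x j * epd i (epd j U) x)
        + (if i = j then t ^ 2 * (1 - 2 * x i * x j / ‖x‖ ^ 2) else 0)
        + t ^ 2 * x i ^ 2 / ‖x‖ ^ 4 * x j ^ 2 := by
      intro j; split_ifs <;> ring
    simp only [e, sum_add_distrib, sum_sub_distrib, sum_ite_eq, mem_univ, if_true, ← mul_sum,
      sum_coord_mul_epd_epd hU hhom hx i, h2]
    field_simp
    ring
  simp only [row, sum_add_distrib, sum_sub_distrib, ← mul_sum, ← sum_div, h2]
  change _ - 2 * t * eucLap U x + _ = _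
  simp only [sum_const, card_univ, Fintype.card_fin, ht]
  push_cast [nsmul_eq_mul]
  field_simp
  ring

end equation

section divergence

variable {x : EuclideanSpace ℝ (Fin (m + 1))}

open MeasureTheory in
lemma integral_epd_eq_zero {Y : EuclideanSpace ℝ (Fin (m + 1)) → ℝ}
    (hY : ContDiff ℝ 1 Y) (hc : HasCompactSupport Y) (i : Fin (m + 1)) :
    Integrable (epd i Y) ∧ ∫ x, epd i Y x = 0 := by
  have hint : Integrable (epd i Y) := by
    refine Continuous.integrable_of_hasCompactSupport ?_ ?_
    · exact (hY.continuous_fderiv (by simp)).clm_apply continuous_const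
    · exact hc.fderiv_apply (𝕜 := ℝ) _
  refine ⟨hint, ?_⟩
  have := integral_mul_fderiv_eq_neg_fderiv_mul_of_integrable (𝕜 := ℝ) (μ := volume)
    (f := fun _ => (1 : ℝ)) (g := Y) (v := EuclideanSpace.single i (1 : ℝ))
    (by simp) (by simp only [one_mul]; exact hint)
    (by simpa using hY.continuous.integrable_of_hasCompactSupport hc)
    (fun _ _ => differentiableAt_const _) (fun x _ => (hY.differentiable (by simp)) x)
  simpa [epd] using this

open MeasureTheory in
/-- A smooth tangential vector field on the punctured space with nonnegative divergence is
divergence free. -/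
lemma divergence_eq_zero_of_nonneg {X : Fin (m + 1) → EuclideanSpace ℝ (Fin (m + 1)) → ℝ}
    (hX : ∀ i, SmoothOffZero (X i)) (htan : ∀ y, y ≠ 0 → ∑ i, y i * X i y = 0)
    (hnn : ∀ y, y ≠ 0 → 0 ≤ ∑ i, epd i (X i) y) (hx : x ≠ 0) :
    ∑ i, epd i (X i) x = 0 := by
  have hr : 0 < ‖x‖ ^ 2 := by positivity
  let b : ContDiffBump (‖x‖ ^ 2) := ⟨‖x‖ ^ 2 / 4, ‖x‖ ^ 2 / 2, by linarith, by linarith⟩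
  have hb : ContDiff ℝ (⊤ : ℕ∞) b := b.contDiff
  let φ : EuclideanSpace ℝ (Fin (m + 1)) → ℝ := fun y => b (‖y‖ ^ 2)
  have hφ : ContDiff ℝ (⊤ : ℕ∞) φ := hb.comp (contDiff_norm_sq ℝ)
  have hφs : SmoothOffZero φ := fun y _ => hφ.contDiffAt
  have hfar : ∀ t : ℝ, ‖x‖ ^ 2 / 2 ≤ |t - ‖x‖ ^ 2| → b t = 0 := fun t ht =>
    b.zero_of_le_dist (by rwa [Real.dist_eq])
  have hφ0 : φ =ᶠ[nhds 0] 0 := by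
    have : ∀ᶠ y : EuclideanSpace ℝ (Fin (m + 1)) in nhds 0, ‖y‖ ^ 2 < ‖x‖ ^ 2 / 2 :=
      (continuous_norm.pow 2).continuousAt.eventually_lt continuousAt_const
        (by simpa using half_pos hr)
    filter_upwards [this] with y hy
    refine hfar _ ?_
    rw [abs_of_nonpos (by linarith)]
    linarith
  have hφc : HasCompactSupport φ := by
    refine HasCompactSupport.intro (isCompact_closedBall 0 (2 * ‖x‖)) fun y hy => hfar _ ?_
    have : 2 * ‖x‖ < ‖y‖ := by simpa using hy
    have : (2 * ‖x‖) ^ 2 < ‖y‖ ^ 2 := by gcongr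
    rw [abs_of_nonneg (by nlinarith)]
    nlinarith
  have hdφ : ∀ i y, epd i φ y = deriv b (‖y‖ ^ 2) * (2 * y i) := by
    intro i y
    have := epd_comp (x := y) (F := fun y => ‖y‖ ^ 2)
      ((hb.differentiable (by simp)) (‖y‖ ^ 2)).hasDerivAt
      ((contDiff_norm_sq ℝ (n := 1)).differentiable (by simp) y) i
    rw [epd_norm_sq] at this
    exact this
  have hY0 : ∀ i, (fun y => φ y * X i y) =ᶠ[nhds 0] fun _ => 0 := fun i => by
    filter_upwards [hφ0] with y hy
    simp [hy]
  have hY : ∀ i, ContDiff ℝ 1 (fun y => φ y * X i y) := by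
    intro i
    rw [contDiff_iff_contDiffAt]
    intro y
    by_cases hy : y = 0
    · subst hy
      exact contDiffAt_const.congr_of_eventuallyEq (hY0 i)
    · exact ((hφs.mul (hX i)) y hy).of_le (by exact_mod_cast le_top)
  have hYc : ∀ i, HasCompactSupport (fun y => φ y * X i y) := fun i => hφc.mul_right
  have hdiv : ∀ y, y ≠ 0 → ∑ i, epd i (fun y => φ y * X i y) y = φ y * ∑ i, epd i (X i) y := by
    intro y hy
    simp only [fun i => epd_mul (hφs.differentiableAt hy) ((hX i).differentiableAt hy) i, hdφ,
      sum_add_distrib, mul_sum]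
    have : ∑ i, deriv b (‖y‖ ^ 2) * (2 * y i) * X i y = 0 := by
      rw [← mul_zero (deriv b (‖y‖ ^ 2) * 2), ← htan y hy, mul_sum]
      exact sum_congr rfl fun i _ => by ring
    rw [this, zero_add]
  have hcont : Continuous fun y => ∑ i, epd i (fun y => φ y * X i y) y :=
    continuous_finsetSum _ fun i _ =>
      ((hY i).continuous_fderiv (by simp)).clm_apply continuous_const
  have hnn' : 0 ≤ fun y => ∑ i, epd i (fun y => φ y * X i y) y := by
    intro y
    by_cases hy : y = 0
    · subst hy
      have : ∀ i, epd i (fun y => φ y * X i y) 0 = 0 := fun i => by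
        simp [epd, (hY0 i).fderiv_eq]
      simp [this]
    · simp only [Pi.zero_apply, hdiv y hy]
      exact mul_nonneg b.nonneg (hnn y hy)
  have hI : ∫ y, ∑ i, epd i (fun y => φ y * X i y) y = 0 := by
    rw [integral_finsetSum _ fun i _ => (integral_epd_eq_zero (hY i) (hYc i) i).1]
    exact sum_eq_zero fun i _ => (integral_epd_eq_zero (hY i) (hYc i) i).2
  have hz := (integral_eq_zero_iff_of_nonneg hnn'
    (integrable_finsetSum _ fun i _ => (integral_epd_eq_zero (hY i) (hYc i) i).1)).1 hI
  have hz' := congrFun ((hcont.ae_eq_iff_eq volume continuous_zero).1 hz) x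
  simp only [hdiv x hx, Pi.zero_apply] at hz'
  have h1 : φ x = 1 := b.one_of_mem_closedBall (Metric.mem_closedBall_self b.rIn_pos.le)
  rwa [h1, one_mul] at hz'

lemma exists_const_of_epd_eq_zero (hm : m ≠ 0) {F : EuclideanSpace ℝ (Fin (m + 1)) → ℝ}
    (hF : SmoothOffZero F) (h : ∀ y, y ≠ 0 → ∀ i, epd i F y = 0) :
    ∃ c, ∀ y, y ≠ 0 → F y = c := by
  have hrank : 1 < Module.rank ℝ (EuclideanSpace ℝ (Fin (m + 1))) := by
    rw [← Module.finrank_eq_rank, finrank_euclideanSpace_fin]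
    exact_mod_cast by omega
  have hpre := (isConnected_compl_singleton_of_one_lt_rank hrank
    (0 : EuclideanSpace ℝ (Fin (m + 1)))).isPreconnected
  obtain ⟨c, hc⟩ := isOpen_compl_singleton.exists_is_const_of_fderiv_eq_zero (𝕜 := ℝ) hpre
    (fun y hy => (hF.differentiableAt hy).differentiableWithinAt) (fun y hy => by
      ext v
      simp [fderiv_apply_eq_sum_epd, h y hy])
  exact ⟨c, fun y hy => hc y hy⟩

end divergence

section rigidity

variable {U : EuclideanSpace ℝ (Fin (m + 1)) → ℝ} {x : EuclideanSpace ℝ (Fin (m + 1))} {κ : ℝ}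

lemma hessian_eq_of_equation (hm : m ≠ 0) (hU : SmoothOffZero U)
    (hpos : ∀ x, x ≠ 0 → 0 < U x)
    (hhom : ∀ x, ∀ c > (0 : ℝ), U (c • x) = c * U x)
    (heq : ∀ x, x ≠ 0 → 2 / m * (U x * eucLap U x) - eucGradSq U x = κ) (hx : x ≠ 0)
    (i j : Fin (m + 1)) :
    epd i (epd j U) x =
      eucLap U x / m * ((if i = j then 1 else 0) - x i * x j / ‖x‖ ^ 2) := by
  have hm' : (m : ℝ) ≠ 0 := Nat.cast_ne_zero.2 hm
  have hm0 : (0 : ℝ) < m := by positivity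
  set g := eucLap U with hgdef
  have hg : SmoothOffZero g := hU.eucLap
  let P : EuclideanSpace ℝ (Fin (m + 1)) → ℝ := fun y => Real.exp (-(m - 2) * Real.log (U y))
  have hP : SmoothOffZero P := fun y hy =>
    (contDiffAt_const.mul ((hU y hy).log (hpos y hy).ne')).exp
  have hdP : ∀ y, y ≠ 0 → ∀ i, epd i P y = P y * (-(m - 2) * (U y)⁻¹) * epd i U y :=
    fun y hy i => epd_comp (((Real.hasDerivAt_log (hpos y hy).ne').const_mul _).exp)
      (hU.differentiableAt hy) i
  let V : EuclideanSpace ℝ (Fin (m + 1)) → ℝ := fun y => ‖y‖ * g y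
  have hV : SmoothOffZero V := SmoothOffZero.norm.mul hg
  have hdV : ∀ i y, y ≠ 0 → epd i V y = y i / ‖y‖ * g y + ‖y‖ * epd i g y := fun i y hy => by
    rw [epd_mul (SmoothOffZero.norm.differentiableAt hy) (hg.differentiableAt hy), epd_norm hy]
  have hddV : ∀ i y, y ≠ 0 → epd i (epd i V) y =
      (1 - y i * y i / ‖y‖ ^ 2) / ‖y‖ * g y + 2 * (y i / ‖y‖ * epd i g y)
        + ‖y‖ * epd i (epd i g) y := fun i y hy => by
    have h1 := SmoothOffZero.coord_div_norm (m := m) i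
    have hn := SmoothOffZero.norm (m := m)
    rw [epd_congr (hdV i) hy, epd_add ((h1.mul hg).differentiableAt hy)
      ((hn.mul (hg.epd i)).differentiableAt hy),
      epd_mul (h1.differentiableAt hy) (hg.differentiableAt hy),
      epd_mul (hn.differentiableAt hy) ((hg.epd i).differentiableAt hy),
      epd_coord_div_norm hy, epd_norm hy, if_pos rfl]
    ring
  let T : EuclideanSpace ℝ (Fin (m + 1)) → ℝ := fun y => ∑ i, ∑ j, (epd i (epd j U) y
        - g y / m * ((if i = j then 1 else 0) - y i * y j / ‖y‖ ^ 2)) ^ 2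
  have hT : ∀ y, 0 ≤ T y := fun y => sum_nonneg fun i _ => sum_nonneg fun j _ => sq_nonneg _
  have htan : ∀ y, y ≠ 0 → ∑ i, y i * epd i V y = 0 := by
    intro y hy
    have hn : ‖y‖ ≠ 0 := norm_ne_zero_iff.2 hy
    have e : ∀ i, y i * epd i V y = g y / ‖y‖ * y i ^ 2 + ‖y‖ * (y i * epd i g y) :=
      fun i => by rw [hdV i y hy]; ring
    simp only [e, sum_add_distrib, ← mul_sum, sum_coord_sq, hgdef,
      sum_coord_mul_epd_eucLap hU hhom hy]
    field_simp
    ring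
  have hdiv : ∀ y, y ≠ 0 → ∑ i, epd i (fun y => P y * epd i V y) y =
      P y * (U y)⁻¹ * m * ‖y‖ * T y := by
    intro y hy
    have hn : ‖y‖ ≠ 0 := norm_ne_zero_iff.2 hy
    have hu := (hpos y hy).ne'
    have e : ∀ i, epd i (fun y => P y * epd i V y) y =
        -(m - 2) * P y * (U y)⁻¹ * g y / ‖y‖ * (y i * epd i U y)
        - (m - 2) * P y * (U y)⁻¹ * ‖y‖ * (epd i U y * epd i g y)
        + P y * g y / ‖y‖ - P y * g y / ‖y‖ ^ 3 * y i ^ 2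
        + 2 * P y / ‖y‖ * (y i * epd i g y) + P y * ‖y‖ * epd i (epd i g) y := by
      intro i
      rw [epd_mul (hP.differentiableAt hy) ((hV.epd i).differentiableAt hy), hdP y hy,
        hdV i y hy, hddV i y hy]
      field_simp
      ring
    simp only [e, sum_add_distrib, sum_sub_distrib, ← mul_sum, sum_coord_sq,
      sum_coord_mul_epd hU hhom hy]
    have h1 := mul_eucLap_eucLap hm hU heq hy
    have h2 : T y = _ := sum_sq_traceFree hm hU hhom hy
    have h3 := sum_coord_mul_epd_eucLap hU hhom hy
    rw [← hgdef] at h1 h2 h3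
    rw [h3, h2]
    change _ + P y * ‖y‖ * eucLap g y = _
    have h4 : eucLap g y = (U y)⁻¹ * ((m - 2) * ∑ i, epd i U y * epd i g y
      + m * ∑ i, ∑ j, epd i (epd j U) y ^ 2 - g y ^ 2) := by
      rw [← h1]; field_simp
    rw [h4]
    simp only [sum_const, card_univ, Fintype.card_fin]
    push_cast [nsmul_eq_mul]
    field_simp
    ring
  have hzero := divergence_eq_zero_of_nonneg (fun i => hP.mul (hV.epd i))
    (fun y hy => by
      rw [← mul_zero (P y), ← htan y hy, mul_sum]
      exact sum_congr rfl fun i _ => by ring)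
    (fun y hy => by
      rw [hdiv y hy]
      have := hpos y hy
      have := hT y
      have : 0 < P y := Real.exp_pos _
      positivity) hx
  rw [hdiv x hx] at hzero
  have hTx : T x = 0 := by
    have h1 := hpos x hx
    have h2 : 0 < P x := Real.exp_pos _
    have h3 : 0 < ‖x‖ := norm_pos_iff.2 hx
    have h4 : P x * (U x)⁻¹ * m * ‖x‖ ≠ 0 := by positivity
    exact (mul_eq_zero.1 hzero).resolve_left h4
  have h1 := (sum_eq_zero_iff_of_nonneg fun i _ => sum_nonneg fun j _ => sq_nonneg _).1 hTx i
    (mem_univ i)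
  have h2 := (sum_eq_zero_iff_of_nonneg fun j _ => sq_nonneg _).1 h1 j (mem_univ j)
  exact sub_eq_zero.1 (pow_eq_zero_iff two_ne_zero |>.1 h2)

lemma exists_eq_mul_norm_add_of_equation (hm : m ≠ 0) (hU : SmoothOffZero U)
    (hpos : ∀ x, x ≠ 0 → 0 < U x)
    (hhom : ∀ x, ∀ c > (0 : ℝ), U (c • x) = c * U x)
    (heq : ∀ x, x ≠ 0 → 2 / m * (U x * eucLap U x) - eucGradSq U x = κ) :
    ∃ (c : ℝ) (L : EuclideanSpace ℝ (Fin (m + 1)) →ₗ[ℝ] ℝ),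
      ∀ x, x ≠ 0 → U x = c * ‖x‖ + L x := by
  have hm' : (m : ℝ) ≠ 0 := Nat.cast_ne_zero.2 hm
  have hess := fun y (hy : y ≠ 0) i j => hessian_eq_of_equation hm hU hpos hhom heq hy i j
  obtain ⟨v, hv⟩ := exists_const_of_epd_eq_zero (F := fun y => ‖y‖ * eucLap U y) hm
    (SmoothOffZero.norm.mul hU.eucLap) (fun y hy i => by
      have hn : ‖y‖ ≠ 0 := norm_ne_zero_iff.2 hy
      have hu := (hpos y hy).ne'
      have h := mul_epd_eucLap hm hU heq hy i
      have e : ∑ j, epd i (epd j U) y * epd j U y =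
          eucLap U y / m * (epd i U y - y i * U y / ‖y‖ ^ 2) := by
        have e : ∀ j, epd i (epd j U) y * epd j U y =
            (if i = j then eucLap U y / m * epd j U y else 0)
              - eucLap U y / m * y i / ‖y‖ ^ 2 * (y j * epd j U y) := fun j => by
          rw [hess y hy i j]; split_ifs <;> ring
        simp only [e, sum_sub_distrib, sum_ite_eq, mem_univ, if_true, ← mul_sum,
          sum_coord_mul_epd hU hhom hy]
        ring
      rw [e] at h
      have h' : epd i (eucLap U) y = -eucLap U y * y i / ‖y‖ ^ 2 := by
        apply mul_left_cancel₀ hu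
        rw [h]
        field_simp
        ring
      rw [epd_mul (SmoothOffZero.norm.differentiableAt hy) (hU.eucLap.differentiableAt hy),
        epd_norm hy, h']
      field_simp
      ring)
  have hlin : ∀ j, ∃ a, ∀ y, y ≠ 0 → epd j U y - v / m * (y j / ‖y‖) = a := fun j => by
    have hq := SmoothOffZero.coord_div_norm (m := m) j
    refine exists_const_of_epd_eq_zero hm ((hU.epd j).sub ((SmoothOffZero.const _).mul hq))
      fun y hy i => ?_
    have hn : ‖y‖ ≠ 0 := norm_ne_zero_iff.2 hy
    rw [epd_sub ((hU.epd j).differentiableAt hy)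
      (((SmoothOffZero.const _).mul hq).differentiableAt hy),
      epd_const_mul (hq.differentiableAt hy), epd_coord_div_norm hy, hess y hy i j, ← hv y hy]
    field_simp
    ring
  choose a ha using hlin
  refine ⟨v / m, ∑ j, a j • (EuclideanSpace.proj (𝕜 := ℝ) j).toLinearMap, fun x hx => ?_⟩
  have hn : ‖x‖ ≠ 0 := norm_ne_zero_iff.2 hx
  have e : ∀ j, x j * epd j U x = v / m / ‖x‖ * x j ^ 2 + a j * x j := fun j => by
    rw [← ha j x hx]; ring
  rw [← sum_coord_mul_epd hU hhom hx]
  simp only [e, sum_add_distrib, ← mul_sum, sum_coord_sq]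
  simp
  field_simp

end rigidity

section conformalFactor

variable {f : EuclideanSpace ℝ (Fin (m + 1)) → ℝ} {x : EuclideanSpace ℝ (Fin (m + 1))}

lemma equation_norm_mul_exp_neg (hm : m ≠ 0) (hf : SmoothOffZero f)
    (hhom : ∀ x, ∀ c > (0 : ℝ), f (c • x) = f x) (hx : x ≠ 0) :
    2 / m * (‖x‖ * Real.exp (-f x) * eucLap (fun y => ‖y‖ * Real.exp (-f y)) x)
        - eucGradSq (fun y => ‖y‖ * Real.exp (-f y)) x =
      Real.exp (-2 * f x) * (1 - 2 / m * ‖x‖ ^ 2 * eucLap f x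
        - (m - 2) / m * ‖x‖ ^ 2 * eucGradSq f x) := by
  have hm' : (m : ℝ) ≠ 0 := Nat.cast_ne_zero.2 hm
  have hn : ‖x‖ ≠ 0 := norm_ne_zero_iff.2 hx
  let w : EuclideanSpace ℝ (Fin (m + 1)) → ℝ := fun y => Real.exp (-f y)
  have hw : SmoothOffZero w := fun y hy => (hf y hy).neg.exp
  have hdw : ∀ i y, y ≠ 0 → epd i w y = -w y * epd i f y := fun i y hy => by
    rw [epd_comp (h := fun t => Real.exp (-t)) ((hasDerivAt_neg _).exp) (hf.differentiableAt hy)]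
    ring
  have hN := SmoothOffZero.norm (m := m)
  have hq := SmoothOffZero.coord_div_norm (m := m)
  have hd : ∀ i y, y ≠ 0 → epd i (fun y => ‖y‖ * w y) y =
      w y * (y i / ‖y‖ - ‖y‖ * epd i f y) := fun i y hy => by
    rw [epd_mul (hN.differentiableAt hy) (hw.differentiableAt hy), epd_norm hy, hdw i y hy]
    ring
  have hdd : ∀ i, epd i (epd i (fun y => ‖y‖ * w y)) x = w x * (1 / ‖x‖
      - 1 / ‖x‖ ^ 3 * x i ^ 2 - 2 / ‖x‖ * (x i * epd i f x) + ‖x‖ * epd i f x ^ 2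
      - ‖x‖ * epd i (epd i f) x) := fun i => by
    rw [epd_congr (hd i) hx, epd_mul (hw.differentiableAt hx)
      (((hq i).sub (hN.mul (hf.epd i))).differentiableAt hx),
      epd_sub ((hq i).differentiableAt hx) ((hN.mul (hf.epd i)).differentiableAt hx),
      epd_mul (hN.differentiableAt hx) ((hf.epd i).differentiableAt hx), hdw i x hx,
      epd_coord_div_norm hx, epd_norm hx, if_pos rfl]
    field_simp
    ring
  have heuler : ∑ i, x i * epd i f x = 0 := by
    simpa using sum_coord_mul_epd_eq_deriv (a := fun _ => 1) hf hx
      (fun c hc => by simpa using hhom x c hc) (hasDerivAt_const _ _)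
  have hlap : eucLap (fun y => ‖y‖ * w y) x =
      w x * (m / ‖x‖ + ‖x‖ * eucGradSq f x - ‖x‖ * eucLap f x) := by
    change ∑ i, epd i (epd i (fun y => ‖y‖ * w y)) x = _
    simp only [hdd, ← mul_sum, sum_add_distrib, sum_sub_distrib, sum_coord_sq, heuler,
      sum_const, card_univ, Fintype.card_fin, eucGradSq, eucLap]
    push_cast [nsmul_eq_mul]
    field_simp
    ring
  have hgrad : eucGradSq (fun y => ‖y‖ * w y) x = w x ^ 2 * (1 + ‖x‖ ^ 2 * eucGradSq f x) := by
    have e : ∀ i, epd i (fun y => ‖y‖ * w y) x ^ 2 = w x ^ 2 * (1 / ‖x‖ ^ 2 * x i ^ 2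
        - 2 * (x i * epd i f x) + ‖x‖ ^ 2 * epd i f x ^ 2) := fun i => by
      rw [hd i x hx]; field_simp; ring
    simp only [eucGradSq, e, ← mul_sum, sum_add_distrib, sum_sub_distrib, sum_coord_sq, heuler]
    field_simp
    ring
  have hexp : Real.exp (-2 * f x) = w x ^ 2 := by
    rw [← Real.exp_nat_mul]; congr 1; push_cast; ring
  change 2 / m * (‖x‖ * w x * eucLap (fun y => ‖y‖ * w y) x)
    - eucGradSq (fun y => ‖y‖ * w y) x = _
  rw [hlap, hgrad, hexp]
  field_simp
  ring

lemma equation_smul {U : EuclideanSpace ℝ (Fin (m + 1)) → ℝ} (hU : SmoothOffZero U)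
    (hhom : ∀ x, ∀ c > (0 : ℝ), U (c • x) = c * U x) (hx : x ≠ 0) {c : ℝ} (hc : 0 < c) :
    2 / m * (U (c • x) * eucLap U (c • x)) - eucGradSq U (c • x) =
      2 / m * (U x * eucLap U x) - eucGradSq U x := by
  have h1 : ∀ i y, y ≠ 0 → epd i U (c • y) = epd i U y := fun i y hy =>
    mul_left_cancel₀ hc.ne' (smul_epd_smul hc.ne' hU (fun z _ => hhom z c hc) hy i)
  have h2 : ∀ i, c * epd i (epd i U) (c • x) = epd i (epd i U) x := fun i => by
    simpa using smul_epd_smul hc.ne' (hU.epd i) (a := 1)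
      (fun z hz => by simpa using h1 i z hz) hx i
  have h3 : c * eucLap U (c • x) = eucLap U x := by
    simp only [eucLap, mul_sum, h2]
  have h4 : eucGradSq U (c • x) = eucGradSq U x := by
    simp only [eucGradSq, h1 _ x hx]
  rw [hhom x c hc, h4, ← h3]
  ring

lemma equation_mul_norm_add_linear (hm : m ≠ 0) {U : EuclideanSpace ℝ (Fin (m + 1)) → ℝ} {c : ℝ}
    {L : EuclideanSpace ℝ (Fin (m + 1)) →ₗ[ℝ] ℝ} (h : ∀ y, y ≠ 0 → U y = c * ‖y‖ + L y)
    (hx : x ≠ 0) :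
    2 / m * (U x * eucLap U x) - eucGradSq U x =
      c ^ 2 - ∑ i, L (EuclideanSpace.single i 1) ^ 2 := by
  have hm' : (m : ℝ) ≠ 0 := Nat.cast_ne_zero.2 hm
  have hn : ‖x‖ ≠ 0 := norm_ne_zero_iff.2 hx
  have hL : SmoothOffZero fun y => L y := fun y _ => L.toContinuousLinearMap.contDiff.contDiffAt
  have hN := SmoothOffZero.norm (m := m)
  have hd : ∀ i y, y ≠ 0 → epd i U y = c * (y i / ‖y‖) + L (EuclideanSpace.single i 1) :=
    fun i y hy => by
      rw [epd_congr h hy, epd_add (((SmoothOffZero.const c).mul hN).differentiableAt hy)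
        (hL.differentiableAt hy), epd_const_mul (hN.differentiableAt hy), epd_norm hy,
        epd_linear]
  have hq := SmoothOffZero.coord_div_norm (m := m)
  have hdd : ∀ i, epd i (epd i U) x = c / ‖x‖ * (1 - 1 / ‖x‖ ^ 2 * x i ^ 2) := fun i => by
    rw [epd_congr (hd i) hx, epd_add (((SmoothOffZero.const c).mul (hq i)).differentiableAt hx)
      (differentiableAt_const _), epd_const_mul ((hq i).differentiableAt hx), epd_const,
      epd_coord_div_norm hx, if_pos rfl]
    ring
  have hLx : ∑ i, x i * L (EuclideanSpace.single i 1) = L x := by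
    simpa only [epd_linear] using sum_coord_mul_epd hL (fun y c _ => by simp) hx
  have hlap : eucLap U x = c * m / ‖x‖ := by
    simp only [eucLap, hdd, ← mul_sum, sum_sub_distrib, sum_coord_sq, sum_const, card_univ,
      Fintype.card_fin]
    push_cast [nsmul_eq_mul]
    field_simp
    ring
  have hgrad : eucGradSq U x =
      c ^ 2 + 2 * c / ‖x‖ * L x + ∑ i, L (EuclideanSpace.single i 1) ^ 2 := by
    have e : ∀ i, epd i U x ^ 2 = c ^ 2 / ‖x‖ ^ 2 * x i ^ 2
        + 2 * c / ‖x‖ * (x i * L (EuclideanSpace.single i 1))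
        + L (EuclideanSpace.single i 1) ^ 2 := fun i => by
      rw [hd i x hx]; ring
    simp only [eucGradSq, e, sum_add_distrib, ← mul_sum, sum_coord_sq, hLx]
    field_simp
  rw [hlap, hgrad, h x hx]
  field_simp
  ring

end conformalFactor

/-- e^{2f}σ has constant scalar curvature iff e^{-f} is a linear combination of
the constant function and first eigenfunctions (restrictions of linear
functions on ℝ^{m+1}) of the Laplacian of the round sphere. -/
theorem yamabe_characterization_round_sphere
    (hm : 3 ≤ m) (f : EuclideanSpace ℝ (Fin (m + 1)) → ℝ)
    (hsmooth : ContDiffOn ℝ (⊤ : ℕ∞) f {x | x ≠ 0})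
    (hhom : ∀ x : EuclideanSpace ℝ (Fin (m + 1)), ∀ c > (0:ℝ), f (c • x) = f x) :
    (∃ K : ℝ, ∀ x ∈ Metric.sphere (0 : EuclideanSpace ℝ (Fin (m + 1))) 1,
        Real.exp (-2 * f x) *
          ((m : ℝ) * (m - 1) - 2 * (m - 1) * eucLap f x
            - (m - 1) * (m - 2) * eucGradSq f x) = K)
    ↔
    (∃ (c₀ : ℝ) (L : EuclideanSpace ℝ (Fin (m + 1)) →ₗ[ℝ] ℝ),
      ∀ x ∈ Metric.sphere (0 : EuclideanSpace ℝ (Fin (m + 1))) 1,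
        Real.exp (-(f x)) = c₀ + L x) := by
  have hm0 : m ≠ 0 := by omega
  have hm1 : (3 : ℝ) ≤ m := by exact_mod_cast hm
  have hm' : (m : ℝ) ≠ 0 := by positivity
  have hm'' : (m : ℝ) - 1 ≠ 0 := by linarith
  have hf : SmoothOffZero f := fun x hx => hsmooth.contDiffAt (isOpen_ne.mem_nhds hx)
  set U : EuclideanSpace ℝ (Fin (m + 1)) → ℝ := fun y => ‖y‖ * Real.exp (-f y) with hUdef
  have hU : SmoothOffZero U := SmoothOffZero.norm.mul fun y hy => (hf y hy).neg.exp
  have hpos : ∀ x, x ≠ 0 → 0 < U x := fun x hx =>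
    mul_pos (norm_pos_iff.2 hx) (Real.exp_pos _)
  have hUhom : ∀ x, ∀ c > (0 : ℝ), U (c • x) = c * U x := fun x c hc => by
    simp only [hUdef, hhom x c hc, norm_smul, Real.norm_of_nonneg hc.le]
    ring
  have hne : ∀ x ∈ Metric.sphere (0 : EuclideanSpace ℝ (Fin (m + 1))) 1, x ≠ 0 := fun x hx =>
    ne_zero_of_mem_unit_sphere ⟨x, hx⟩
  have hnormalize : ∀ x : EuclideanSpace ℝ (Fin (m + 1)), x ≠ 0 →
      ∃ y ∈ Metric.sphere (0 : EuclideanSpace ℝ (Fin (m + 1))) 1, x = ‖x‖ • y := fun x hx => by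
    have hn : ‖x‖ ≠ 0 := norm_ne_zero_iff.2 hx
    refine ⟨‖x‖⁻¹ • x, ?_, ?_⟩
    · simp [norm_smul, hn]
    · rw [smul_smul, mul_inv_cancel₀ hn, one_smul]
  have hscal : ∀ x ∈ Metric.sphere (0 : EuclideanSpace ℝ (Fin (m + 1))) 1,
      Real.exp (-2 * f x) *
          ((m : ℝ) * (m - 1) - 2 * (m - 1) * eucLap f x
            - (m - 1) * (m - 2) * eucGradSq f x) =
        m * (m - 1) * (2 / m * (U x * eucLap U x) - eucGradSq U x) := fun x hx => by
    have hx1 : ‖x‖ = 1 := by simpa using hx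
    rw [equation_norm_mul_exp_neg hm0 hf hhom (hne x hx), hx1]
    field_simp
  have hUf : ∀ x ∈ Metric.sphere (0 : EuclideanSpace ℝ (Fin (m + 1))) 1,
      U x = Real.exp (-(f x)) := fun x hx => by
    have hx1 : ‖x‖ = 1 := by simpa using hx
    simp [hUdef, hx1]
  constructor
  · rintro ⟨K, hK⟩
    obtain ⟨c, L, hL⟩ := exists_eq_mul_norm_add_of_equation (κ := K / (m * (m - 1))) hm0 hU hpos
      hUhom fun x hx => by
        obtain ⟨y, hy, hxy⟩ := hnormalize x hx
        rw [hxy, equation_smul hU hUhom (hne y hy) (norm_pos_iff.2 hx), eq_div_iff (by positivity),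
          ← hK y hy, hscal y hy]
        ring
    refine ⟨c, L, fun x hx => ?_⟩
    have hx1 : ‖x‖ = 1 := by simpa using hx
    rw [← hUf x hx, hL x (hne x hx), hx1, mul_one]
  · rintro ⟨c, L, hL⟩
    refine ⟨m * (m - 1) * (c ^ 2 - ∑ i, L (EuclideanSpace.single i 1) ^ 2), fun x hx => ?_⟩
    rw [hscal x hx, equation_mul_norm_add_linear hm0 (c := c) (L := L) (fun y hy => ?_)
      (hne x hx)]
    obtain ⟨z, hz, hyz⟩ := hnormalize y hy
    have hn := norm_pos_iff.2 hy
    generalize ‖y‖ = r at hyz hn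
    rw [hyz, hUhom z r hn, hUf z hz, hL z hz, map_smul, smul_eq_mul]
    ring
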